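/- If Ψ > k^{3/2}, then the columns F_{:,1},…,F_{:,k} of the k×k matrix F defined by F_{j,i} = α_j^{(i)} are linearly independent. -/

import Mathlib

open Finset BigOperators Matrix

namespace SpectralClustering

variable {V : Type} [Fintype V] [DecidableEq V]

/-- Volume of a vertex set: the sum of the degrees of its vertices. -/
def vol (G : SimpleGraph V) [DecidableRel G.Adj] (S : Finset V) : ℕ :=
  ∑ v ∈ S, G.degree v

/-- Number of edges between two (disjoint) vertex sets. -/
def cut (G : SimpleGraph V) [DecidableRel G.Adj] (S T : Finset V) : ℕ :=
  ∑ u ∈ S, (T.filter fun v => G.Adj u v).card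

/-- Conductance `φ(S) = |E(S, V \ S)| / μ(S)`. -/
noncomputable def conductance (G : SimpleGraph V) [DecidableRel G.Adj] (S : Finset V) : ℝ :=
  (cut G S Sᶜ : ℝ) / (vol G S : ℝ)

/-- A `k`-way partition of the vertex set into nonempty blocks. -/
def IsKWayPartition {k : ℕ} (P : Fin k → Finset V) : Prop :=
  (∀ i, (P i).Nonempty) ∧ (∀ i j, i ≠ j → Disjoint (P i) (P j)) ∧
    (∀ v : V, ∃ i, v ∈ P i)

/-- Maximum conductance over the blocks of a tuple of sets. -/
noncomputable def maxCond (G : SimpleGraph V) [DecidableRel G.Adj] {k : ℕ}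
    (P : Fin k → Finset V) : ℝ :=
  ⨆ i, conductance G (P i)

/-- Average conductance of the blocks. -/
noncomputable def avgCond (G : SimpleGraph V) [DecidableRel G.Adj] {k : ℕ}
    (P : Fin k → Finset V) : ℝ :=
  (∑ i, conductance G (P i)) / (k : ℝ)

/-- `P` achieves `ρ̂_avr(k)`: it minimizes the maximum conductance among all
`k`-way partitions, and among those it has minimal average conductance. -/
def AchievesRhoAvr (G : SimpleGraph V) [DecidableRel G.Adj] {k : ℕ}
    (P : Fin k → Finset V) : Prop :=
  IsKWayPartition P ∧
  (∀ Q : Fin k → Finset V, IsKWayPartition Q → maxCond G P ≤ maxCond G Q) ∧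
  (∀ Q : Fin k → Finset V, IsKWayPartition Q → maxCond G Q = maxCond G P →
    avgCond G P ≤ avgCond G Q)

/-- Dot product of two vectors indexed by the vertices. -/
def dotV (x y : V → ℝ) : ℝ := ∑ v, x v * y v

/-- The normalized Laplacian `I - D^{-1/2} A D^{-1/2}`. -/
noncomputable def normLap (G : SimpleGraph V) [DecidableRel G.Adj] : Matrix V V ℝ :=
  1 - Matrix.diagonal (fun v => (Real.sqrt (G.degree v))⁻¹) * G.adjMatrix ℝ *
      Matrix.diagonal (fun v => (Real.sqrt (G.degree v))⁻¹)

/-- `f` is an orthonormal family of eigenvectors of the normalized Laplacian of `G`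
with (sorted) eigenvalues `lam`. -/
structure EigenData (G : SimpleGraph V) [DecidableRel G.Adj]
    (f : Fin (Fintype.card V) → V → ℝ) (lam : Fin (Fintype.card V) → ℝ) : Prop where
  eig : ∀ i, (normLap G).mulVec (f i) = lam i • f i
  ortho : ∀ i j, dotV (f i) (f j) = if i = j then (1 : ℝ) else 0
  mono : Monotone lam

/-- The gap parameter `Ψ = λ_{k+1} / ρ̂_avr(k)`, where `ρ̂_avr(k)` is realized as the
average conductance of the fixed optimal partition `P`. -/
noncomputable def Psi (G : SimpleGraph V) [DecidableRel G.Adj]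
    (lam : Fin (Fintype.card V) → ℝ) {k : ℕ} (P : Fin k → Finset V)
    (hkn : k < Fintype.card V) : ℝ :=
  lam ⟨k, hkn⟩ / avgCond G P

/-- The spectral embedding `F(u) = d_u^{-1/2} (f_1(u), …, f_k(u))`. -/
noncomputable def Femb (G : SimpleGraph V) [DecidableRel G.Adj]
    (f : Fin (Fintype.card V) → V → ℝ) {k : ℕ} (hk : k ≤ Fintype.card V) (u : V) :
    Fin k → ℝ :=
  fun j => f (Fin.castLE hk j) u / Real.sqrt (G.degree u)

/-- `k`-means cost of a clustering of the (degree-weighted) spectral embedding: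
`∑_i ∑_{u ∈ A_i} d_u ‖F(u) - c_i‖²`. -/
noncomputable def kmCost (G : SimpleGraph V) [DecidableRel G.Adj]
    (f : Fin (Fintype.card V) → V → ℝ) {k : ℕ} (hk : k ≤ Fintype.card V) {ℓ : ℕ}
    (A : Fin ℓ → Finset V) (c : Fin ℓ → Fin k → ℝ) : ℝ :=
  ∑ i, ∑ u ∈ A i, (G.degree u : ℝ) * ∑ j, (Femb G f hk u j - c i j) ^ 2

/-- `Δ_ℓ(𝒳_V)`: the optimal `ℓ`-means cost of the spectral embedding multiset `𝒳_V`
(which contains `d_u` copies of `F(u)` for every vertex `u`). -/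
noncomputable def kmOpt (G : SimpleGraph V) [DecidableRel G.Adj]
    (f : Fin (Fintype.card V) → V → ℝ) {k : ℕ} (hk : k ≤ Fintype.card V) (ℓ : ℕ) : ℝ :=
  sInf { r : ℝ | ∃ (A : Fin ℓ → Finset V) (c : Fin ℓ → Fin k → ℝ),
    (∀ i j, i ≠ j → Disjoint (A i) (A j)) ∧ (∀ v : V, ∃ i, v ∈ A i) ∧
    r = kmCost G f hk A c }

/-- Normalized characteristic vector `ḡ_i = D^{1/2} χ_{P_i} / √μ(P_i)`. -/
noncomputable def gbar (G : SimpleGraph V) [DecidableRel G.Adj] {k : ℕ}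
    (P : Fin k → Finset V) (i : Fin k) : V → ℝ :=
  fun v => (if v ∈ P i then Real.sqrt (G.degree v) else 0) / Real.sqrt (vol G (P i))

/-- Coefficients `α_j^{(i)} = ⟨ḡ_i, f_j⟩` of `ḡ_i` in the eigenbasis. -/
noncomputable def alpha (G : SimpleGraph V) [DecidableRel G.Adj] {k : ℕ}
    (P : Fin k → Finset V) (f : Fin (Fintype.card V) → V → ℝ)
    (i : Fin k) (j : Fin (Fintype.card V)) : ℝ :=
  dotV (gbar G P i) (f j)

/-- Projection `f̂_i = ∑_{j=1}^k α_j^{(i)} f_j` of `ḡ_i` onto the first `k` eigenvectors. -/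
noncomputable def fhat (G : SimpleGraph V) [DecidableRel G.Adj] {k : ℕ}
    (P : Fin k → Finset V) (f : Fin (Fintype.card V) → V → ℝ) (i : Fin k) : V → ℝ :=
  fun v => ∑ j : Fin (Fintype.card V),
    if (j : ℕ) < k then alpha G P f i j * f j v else 0

/-- Estimation center `p^{(i)} = μ(P_i)^{-1/2} (β_i^{(1)}, …, β_i^{(k)})`;
here `beta i j` denotes `β_j^{(i)}`. -/
noncomputable def estCenter (G : SimpleGraph V) [DecidableRel G.Adj] {k : ℕ}
    (P : Fin k → Finset V) (beta : Fin k → Fin k → ℝ) (i : Fin k) : Fin k → ℝ :=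
  fun j => beta j i / Real.sqrt (vol G (P i))

theorem dotV_eq_dotProduct {V : Type} [Fintype V] (x y : V → ℝ) : dotV x y = x ⬝ᵥ y := rfl

theorem EigenData.dotV_eq_sum {V : Type} [Fintype V] [DecidableEq V] {G : SimpleGraph V}
    [DecidableRel G.Adj] {f : Fin (Fintype.card V) → V → ℝ} {lam : Fin (Fintype.card V) → ℝ}
    (hf : EigenData G f lam) (x y : V → ℝ) :
    dotV x y = ∑ j, dotV x (f j) * dotV y (f j) := by
  let M : Matrix (Fin (Fintype.card V)) V ℝ := Matrix.of f
  have hM : M * Mᵀ = 1 := by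
    ext i j
    rw [Matrix.one_apply, ← hf.ortho i j]
    rfl
  have hM' : Mᵀ * M = 1 := (Matrix.mul_eq_one_comm_of_card_eq _ _ _ (by simp)).mp hM
  have hx (z : V → ℝ) (j) : dotV z (f j) = (M *ᵥ z) j := dotProduct_comm _ _
  calc dotV x y = x ⬝ᵥ ((Mᵀ * M) *ᵥ y) := by rw [hM', Matrix.one_mulVec]; rfl
    _ = (M *ᵥ x) ⬝ᵥ (M *ᵥ y) := by
      rw [← Matrix.mulVec_mulVec, Matrix.dotProduct_mulVec, Matrix.vecMul_transpose]
    _ = _ := by simp only [hx]; rfl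

theorem normLap_isSymm {V : Type} [Fintype V] [DecidableEq V] (G : SimpleGraph V)
    [DecidableRel G.Adj] : (normLap G).IsSymm := by
  unfold Matrix.IsSymm normLap
  simp [Matrix.transpose_sub, Matrix.transpose_mul, Matrix.mul_assoc]

theorem EigenData.dotV_normLap_eq_sum {V : Type} [Fintype V] [DecidableEq V]
    {G : SimpleGraph V} [DecidableRel G.Adj] {f : Fin (Fintype.card V) → V → ℝ}
    {lam : Fin (Fintype.card V) → ℝ} (hf : EigenData G f lam) (x : V → ℝ) :
    dotV x (normLap G *ᵥ x) = ∑ j, lam j * dotV x (f j) ^ 2 := by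
  rw [hf.dotV_eq_sum]
  refine Finset.sum_congr rfl fun j _ => ?_
  have h : dotV (normLap G *ᵥ x) (f j) = lam j * dotV x (f j) := by
    rw [dotV_eq_dotProduct, dotProduct_comm, Matrix.dotProduct_mulVec, ← Matrix.mulVec_transpose,
      normLap_isSymm G, hf.eig, smul_dotProduct, dotProduct_comm]
    rfl
  rw [h]
  ring

/-- The quadratic form of the normalized Laplacian as a sum over ordered adjacent pairs. -/
theorem dotV_normLap {V : Type} [Fintype V] [DecidableEq V] (G : SimpleGraph V)
    [DecidableRel G.Adj] (hd : ∀ v, 0 < G.degree v) (y : V → ℝ) :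
    dotV (fun v => Real.sqrt (G.degree v) * y v)
        (normLap G *ᵥ fun v => Real.sqrt (G.degree v) * y v) =
      (∑ u, ∑ v, if G.Adj u v then (y u - y v) ^ 2 else 0) / 2 := by
  have hs (v : V) : Real.sqrt (G.degree v) ≠ 0 :=
    (Real.sqrt_pos.mpr (by exact_mod_cast hd v)).ne'
  have hlap : dotV (fun v => Real.sqrt (G.degree v) * y v)
      (normLap G *ᵥ fun v => Real.sqrt (G.degree v) * y v) = y ⬝ᵥ (G.lapMatrix ℝ *ᵥ y) := by
    have hy : (Matrix.diagonal fun v => (Real.sqrt (G.degree v))⁻¹) *ᵥ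
        (fun v => Real.sqrt (G.degree v) * y v) = y := by
      ext v
      simp [Matrix.mulVec_diagonal, hs v]
    rw [normLap, SimpleGraph.lapMatrix, SimpleGraph.degMatrix, Matrix.sub_mulVec, Matrix.sub_mulVec,
      ← Matrix.mulVec_mulVec, ← Matrix.mulVec_mulVec, hy, Matrix.one_mulVec]
    refine Finset.sum_congr rfl fun v _ => ?_
    have h2 := Real.mul_self_sqrt (Nat.cast_nonneg (α := ℝ) (G.degree v))
    have h3 := hs v
    simp only [Pi.sub_apply, Matrix.mulVec_diagonal]
    field_simp
    rw [sq, h2]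
    ring
  rw [hlap, ← Matrix.toLinearMap₂'_apply', SimpleGraph.lapMatrix_toLinearMap₂']

theorem dotV_normLap_nonneg {V : Type} [Fintype V] [DecidableEq V] (G : SimpleGraph V)
    [DecidableRel G.Adj] (hd : ∀ v, 0 < G.degree v) (x : V → ℝ) :
    0 ≤ dotV x (normLap G *ᵥ x) := by
  have hx : x = fun v => Real.sqrt (G.degree v) * (x v / Real.sqrt (G.degree v)) := by
    ext v
    have : Real.sqrt (G.degree v) ≠ 0 := (Real.sqrt_pos.mpr (by exact_mod_cast hd v)).ne'
    field_simp
  rw [hx, dotV_normLap G hd]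
  refine div_nonneg (Finset.sum_nonneg fun u _ => Finset.sum_nonneg fun v _ => ?_) zero_le_two
  split_ifs <;> positivity

theorem EigenData.lam_nonneg {V : Type} [Fintype V] [DecidableEq V]
    {G : SimpleGraph V} [DecidableRel G.Adj] {f : Fin (Fintype.card V) → V → ℝ}
    {lam : Fin (Fintype.card V) → ℝ} (hf : EigenData G f lam)
    (hd : ∀ v, 0 < G.degree v) (j : Fin (Fintype.card V)) : 0 ≤ lam j := by
  have h := dotV_normLap_nonneg G hd (f j)
  rw [hf.eig, dotV_eq_dotProduct, dotProduct_smul, ← dotV_eq_dotProduct, hf.ortho] at h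
  simpa using h

theorem vol_pos {V : Type} [Fintype V] [DecidableEq V] (G : SimpleGraph V)
    [DecidableRel G.Adj] (hd : ∀ v, 0 < G.degree v) {S : Finset V} (hS : S.Nonempty) :
    0 < vol G S :=
  Finset.sum_pos (fun v _ => hd v) hS

theorem sum_adj_indicator_sub_sq {V : Type} [Fintype V] [DecidableEq V] (G : SimpleGraph V)
    [DecidableRel G.Adj] (S : Finset V) (a : ℝ) :
    (∑ u, ∑ v, if G.Adj u v then
      ((if u ∈ S then a else 0) - (if v ∈ S then a else 0)) ^ 2 else 0) =
      2 * (cut G S Sᶜ * a ^ 2) := by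
  have hcut : (cut G S Sᶜ : ℝ) * a ^ 2 =
      ∑ u, ∑ v, if u ∈ S ∧ v ∉ S ∧ G.Adj u v then a ^ 2 else 0 := by
    rw [cut, Nat.cast_sum, Finset.sum_mul, ← Finset.univ_inter S, ← Finset.sum_ite_mem]
    refine Finset.sum_congr rfl fun u _ => ?_
    by_cases hu : u ∈ S
    · have hfilter : (Sᶜ.filter fun v => G.Adj u v) =
          Finset.univ.filter fun v => v ∉ S ∧ G.Adj u v := by
        ext v
        simp
      simp only [hu, if_true, true_and, hfilter, ← Finset.sum_filter, Finset.sum_const,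
        nsmul_eq_mul, Finset.univ_inter]
    · simp [hu]
  have hcomm : (cut G S Sᶜ : ℝ) * a ^ 2 =
      ∑ u, ∑ v, if v ∈ S ∧ u ∉ S ∧ G.Adj v u then a ^ 2 else 0 := by
    rw [hcut, Finset.sum_comm]
  rw [two_mul]
  nth_rewrite 1 [hcut]
  rw [hcomm, ← Finset.sum_add_distrib]
  refine Finset.sum_congr rfl fun u _ => ?_
  rw [← Finset.sum_add_distrib]
  refine Finset.sum_congr rfl fun v _ => ?_
  by_cases hu : u ∈ S <;> by_cases hv : v ∈ S <;> by_cases h : G.Adj u v <;>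
    simp [hu, hv, h, G.adj_comm v u]

theorem dotV_normLap_gbar {V : Type} [Fintype V] [DecidableEq V] (G : SimpleGraph V)
    [DecidableRel G.Adj] (hd : ∀ v, 0 < G.degree v) {k : ℕ} (P : Fin k → Finset V) (i : Fin k) :
    dotV (gbar G P i) (normLap G *ᵥ gbar G P i) = conductance G (P i) := by
  have hg : gbar G P i = fun v => Real.sqrt (G.degree v) *
      (if v ∈ P i then (Real.sqrt (vol G (P i)))⁻¹ else 0) := by
    ext v
    by_cases hv : v ∈ P i <;> simp [gbar, hv, div_eq_mul_inv]
  rw [hg, dotV_normLap G hd, sum_adj_indicator_sub_sq, inv_pow, Real.sq_sqrt (Nat.cast_nonneg _),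
    conductance]
  ring

theorem dotV_gbar {V : Type} [Fintype V] [DecidableEq V] (G : SimpleGraph V)
    [DecidableRel G.Adj] (hd : ∀ v, 0 < G.degree v) {k : ℕ} {P : Fin k → Finset V}
    (hP : IsKWayPartition P) (i j : Fin k) :
    dotV (gbar G P i) (gbar G P j) = if i = j then 1 else 0 := by
  split_ifs with hij
  · subst hij
    have hv : (vol G (P i) : ℝ) ≠ 0 := by exact_mod_cast (vol_pos G hd (hP.1 i)).ne'
    have h (v : V) : gbar G P i v * gbar G P i v =
        (if v ∈ P i then (G.degree v : ℝ) else 0) / vol G (P i) := by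
      rw [gbar, div_mul_div_comm, Real.mul_self_sqrt (Nat.cast_nonneg _)]
      by_cases hv : v ∈ P i <;> simp [hv]
    simp only [dotV, h]
    rw [← Finset.sum_div, Finset.sum_ite_mem, Finset.univ_inter, ← Nat.cast_sum]
    exact div_self hv
  · refine Finset.sum_eq_zero fun v _ => ?_
    by_cases hv : v ∈ P i
    · simp [gbar, Finset.disjoint_left.mp (hP.2.1 i j hij) hv]
    · simp [gbar, hv]

/-- If a combination of the `gbar G P i` is orthogonal to the first `k` eigenvectors, then its
squared norm times `λ_{k+1}` is at most its coefficient norm times the total conductance. -/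
theorem lam_mul_sum_sq_le {V : Type} [Fintype V] [DecidableEq V] {G : SimpleGraph V}
    [DecidableRel G.Adj] (hd : ∀ v, 0 < G.degree v) {k : ℕ} (hkn : k < Fintype.card V)
    {f : Fin (Fintype.card V) → V → ℝ} {lam : Fin (Fintype.card V) → ℝ}
    (hf : EigenData G f lam) {P : Fin k → Finset V} (hP : IsKWayPartition P) (c : Fin k → ℝ)
    (hc : ∀ j : Fin k, ∑ i, c i * alpha G P f i (Fin.castLE hkn.le j) = 0) :
    lam ⟨k, hkn⟩ * ∑ i, c i ^ 2 ≤ (∑ i, c i ^ 2) * ∑ i, conductance G (P i) := by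
  have hnorm : ∑ i, c i ^ 2 = ∑ j, (∑ i, c i * alpha G P f i j) ^ 2 := by
    have hexp (j) : (∑ i, c i * alpha G P f i j) ^ 2 =
        ∑ i, ∑ l, c i * c l * (alpha G P f i j * alpha G P f l j) := by
      rw [sq, Finset.sum_mul_sum]
      exact Finset.sum_congr rfl fun i _ => Finset.sum_congr rfl fun l _ => by ring
    simp only [hexp]
    rw [Finset.sum_comm]
    refine Finset.sum_congr rfl fun i _ => ?_
    rw [Finset.sum_comm]
    simp only [← Finset.mul_sum, alpha, ← hf.dotV_eq_sum, dotV_gbar G hd hP]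
    simp [sq]
  have hcond (i) : conductance G (P i) = ∑ j, lam j * alpha G P f i j ^ 2 := by
    rw [← dotV_normLap_gbar G hd, hf.dotV_normLap_eq_sum]
    rfl
  calc lam ⟨k, hkn⟩ * ∑ i, c i ^ 2
      = ∑ j, lam ⟨k, hkn⟩ * (∑ i, c i * alpha G P f i j) ^ 2 := by rw [hnorm, Finset.mul_sum]
    _ ≤ ∑ j, lam j * (∑ i, c i * alpha G P f i j) ^ 2 := by
      refine Finset.sum_le_sum fun j _ => ?_
      rcases lt_or_ge (j : ℕ) k with h | h
      · have h0 : ∑ i, c i * alpha G P f i j = 0 := hc ⟨j, h⟩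
        simp [h0]
      · exact mul_le_mul_of_nonneg_right (hf.mono (Fin.mk_le_of_le_val h)) (sq_nonneg _)
    _ ≤ ∑ j, lam j * ((∑ i, c i ^ 2) * ∑ i, alpha G P f i j ^ 2) :=
      Finset.sum_le_sum fun j _ =>
        mul_le_mul_of_nonneg_left (Finset.sum_mul_sq_le_sq_mul_sq _ _ _) (hf.lam_nonneg hd j)
    _ = (∑ i, c i ^ 2) * ∑ i, conductance G (P i) := by
      simp only [hcond]
      rw [Finset.sum_comm, Finset.mul_sum]
      refine Finset.sum_congr rfl fun j _ => ?_
      rw [← Finset.mul_sum]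
      ring

theorem columns_of_F_linearly_independent
    {V : Type} [Fintype V] [DecidableEq V] (G : SimpleGraph V) [DecidableRel G.Adj]
    (hd : ∀ v : V, 0 < G.degree v)
    {k : ℕ} (hkn : k < Fintype.card V)
    (f : Fin (Fintype.card V) → V → ℝ) (lam : Fin (Fintype.card V) → ℝ)
    (hf : EigenData G f lam)
    (P : Fin k → Finset V) (hP : AchievesRhoAvr G P)
    (hPsi : Psi G lam P hkn > Real.sqrt ((k : ℝ) ^ 3)) :
    LinearIndependent ℝ
      (fun i : Fin k => fun j : Fin k => alpha G P f i (Fin.castLE hkn.le j)) := by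
  rw [Fintype.linearIndependent_iff]
  intro c hc i
  have hk : (1 : ℝ) ≤ k := by exact_mod_cast i.pos
  have hle := lam_mul_sum_sq_le hd hkn hf hP.1 c fun j => by
    simpa using congrFun hc j
  have hsqrt : (k : ℝ) ≤ Real.sqrt ((k : ℝ) ^ 3) :=
    Real.le_sqrt_of_sq_le (pow_le_pow_right₀ hk (by norm_num))
  have havg0 : 0 ≤ avgCond G P :=
    div_nonneg (Finset.sum_nonneg fun i _ => by unfold conductance; positivity) (Nat.cast_nonneg k)
  have havg : 0 < avgCond G P := by
    refine havg0.lt_of_ne fun h => ?_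
    rw [Psi, ← h, div_zero] at hPsi
    exact (Real.sqrt_nonneg _).not_gt hPsi
  have hlt : ∑ i, conductance G (P i) < lam ⟨k, hkn⟩ := by
    have h := (lt_div_iff₀ havg).mp (hsqrt.trans_lt hPsi)
    rwa [avgCond, mul_div_cancel₀ _ (by positivity)] at h
  have hnn : 0 ≤ ∑ i, c i ^ 2 := Finset.sum_nonneg fun i _ => sq_nonneg (c i)
  have hzero : ∑ i, c i ^ 2 = 0 := by nlinarith
  exact pow_eq_zero_iff two_ne_zero |>.mp
    ((Finset.sum_eq_zero_iff_of_nonneg fun i _ => sq_nonneg (c i)).mp hzero i (Finset.mem_univ i))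

end SpectralClustering
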